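/- arXiv:2303.16547 — 3 statements merged into one kernel-verified Lean document; each statement's English description precedes it below -/
import Mathlib

section
/- Let n be even, let f : 𝔽₂ⁿ → 𝔽₂ be a bent function and let Γ ⊂ 𝔽₂ⁿ be a linear hyperplane (a linear subspace of dimension n−1). Define h : 𝔽₂ⁿ → 𝔽₂ as the support indicator of the Fourier transform of (−1)^f·1_Γ, i.e., h(y) = 1 if and only if ∑_{x ∈ Γ} (−1)^{f(x) ⊕ ⟨x,y⟩} ≠ 0. Then the algebraic degree of h is at most n/2. -/
open scoped Classical

/-- Inner product on 𝔽₂ⁿ. -/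
def ip {n : ℕ} (x y : Fin n → ZMod 2) : ZMod 2 := ∑ i, x i * y i

/-- Walsh–Hadamard transform of a Boolean function. -/
def walsh {n : ℕ} (f : (Fin n → ZMod 2) → ZMod 2) (y : Fin n → ZMod 2) : ℤ :=
  ∑ x, (-1 : ℤ) ^ (f x + ip x y).val

/-- `f` is bent: all Walsh coefficients are `±2^(n/2)`. -/
def IsBent {n : ℕ} (f : (Fin n → ZMod 2) → ZMod 2) : Prop :=
  ∀ y, walsh f y = 2 ^ (n / 2) ∨ walsh f y = -2 ^ (n / 2)

/-- Hamming weight of a vector in 𝔽₂ⁿ. -/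
def wt {n : ℕ} (y : Fin n → ZMod 2) : ℕ := ∑ i, (y i).val

/-- Möbius transform of a Boolean function. -/
def mobius {n : ℕ} (f : (Fin n → ZMod 2) → ZMod 2) (y : Fin n → ZMod 2) : ZMod 2 :=
  ∑ x ∈ Finset.univ.filter (fun x : Fin n → ZMod 2 => ∀ i, x i * y i = x i), f x

/-- Algebraic degree of a Boolean function. -/
def degree {n : ℕ} (f : (Fin n → ZMod 2) → ZMod 2) : ℕ :=
  (Finset.univ.filter (fun y => mobius f y = 1)).sup wt

theorem neg_one_pow_val_add (a b : ZMod 2) :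
    (-1 : ℤ) ^ (a + b).val = (-1) ^ a.val * (-1) ^ b.val := by
  revert a b; decide

theorem neg_one_pow_val_sum {ι : Type*} (s : Finset ι) (a : ι → ZMod 2) :
    (-1 : ℤ) ^ (∑ i ∈ s, a i).val = ∏ i ∈ s, (-1) ^ (a i).val := by
  classical
  induction s using Finset.induction_on with
  | empty => simp
  | insert i s hi ih => rw [Finset.sum_insert hi, Finset.prod_insert hi, neg_one_pow_val_add, ih]

theorem ip_add_right {n : ℕ} (x y z : Fin n → ZMod 2) : ip x (y + z) = ip x y + ip x z := by
  simp [ip, mul_add, Finset.sum_add_distrib]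

/-- A character sum over the subcube below `y` is divisible by the size of the subcube. -/
theorem two_pow_wt_dvd_sum_subcube {n : ℕ} (u y : Fin n → ZMod 2) :
    (2 : ℤ) ^ wt y ∣ ∑ x ∈ Finset.univ.filter
      (fun x : Fin n → ZMod 2 => ∀ i, x i * y i = x i), (-1 : ℤ) ^ (ip u x).val := by
  have hset : Finset.univ.filter (fun x : Fin n → ZMod 2 => ∀ i, x i * y i = x i) =
      Fintype.piFinset fun i => Finset.univ.filter fun a : ZMod 2 => a * y i = a := by
    ext x; simp
  have hfactor : ∀ b c : ZMod 2, (2 : ℤ) ^ b.val ∣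
      ∑ a ∈ Finset.univ.filter (fun a : ZMod 2 => a * b = a), (-1 : ℤ) ^ (c * a).val := by
    decide
  simp only [hset, ip, neg_one_pow_val_sum]
  rw [← Finset.prod_univ_sum (fun i => Finset.univ.filter fun a : ZMod 2 => a * y i = a)
    (fun i a => (-1 : ℤ) ^ (u i * a).val), wt, ← Finset.prod_pow_eq_pow_sum]
  exact Finset.prod_dvd_prod_of_dvd _ _ fun i _ => hfactor _ _

/-- A subspace of `𝔽₂ⁿ` of dimension `n - 1` is the orthogonal of a vector. -/
theorem exists_mem_iff_ip_eq_zero {n : ℕ} (Γ : Submodule (ZMod 2) (Fin n → ZMod 2))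
    (hΓ : Module.finrank (ZMod 2) Γ = n - 1) :
    ∃ v : Fin n → ZMod 2, ∀ x, x ∈ Γ ↔ ip x v = 0 := by
  have key : ∃ φ : (Fin n → ZMod 2) →ₗ[ZMod 2] ZMod 2, Γ = LinearMap.ker φ := by
    by_cases htop : Γ = ⊤
    · exact ⟨0, by simp [htop]⟩
    · obtain ⟨φ, hφ, hle⟩ := Γ.exists_le_ker_of_lt_top (lt_top_iff_ne_top.2 htop)
      refine ⟨φ, Submodule.eq_of_le_of_finrank_le hle ?_⟩
      have hlt := Submodule.finrank_lt (s := LinearMap.ker φ) (by simpa using hφ)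
      rw [Module.finrank_fin_fun] at hlt
      omega
  obtain ⟨φ, rfl⟩ := key
  refine ⟨fun i => φ fun j => if i = j then 1 else 0, fun x => ?_⟩
  rw [LinearMap.mem_ker, LinearMap.pi_apply_eq_sum_univ φ x, ip]
  simp only [smul_eq_mul]

/-- Fourier coefficient of `(-1)^f` restricted to a subspace. -/
noncomputable def fourierRestrict {n : ℕ} (f : (Fin n → ZMod 2) → ZMod 2)
    (Γ : Submodule (ZMod 2) (Fin n → ZMod 2)) (y : Fin n → ZMod 2) : ℤ :=
  ∑ x ∈ Finset.univ.filter (fun x : Fin n → ZMod 2 => x ∈ Γ), (-1 : ℤ) ^ (f x + ip x y).val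

theorem two_mul_fourierRestrict {n : ℕ} (f : (Fin n → ZMod 2) → ZMod 2)
    {Γ : Submodule (ZMod 2) (Fin n → ZMod 2)} {v : Fin n → ZMod 2}
    (hv : ∀ x, x ∈ Γ ↔ ip x v = 0) (y : Fin n → ZMod 2) :
    2 * fourierRestrict f Γ y = walsh f y + walsh f (y + v) := by
  have hsign : ∀ a b : ZMod 2, (if b = 0 then 2 * (-1 : ℤ) ^ a.val else 0) =
      (-1) ^ a.val + (-1) ^ (a + b).val := by decide
  simp only [fourierRestrict, walsh, hv, Finset.mul_sum, Finset.sum_filter, mul_ite, mul_zero,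
    ← Finset.sum_add_distrib, ip_add_right, ← add_assoc, ← hsign]

/-- The sum of the restricted Fourier coefficients over the subcube below `y`. -/
theorem two_pow_wt_dvd_sum_fourierRestrict {n : ℕ} (f : (Fin n → ZMod 2) → ZMod 2)
    (Γ : Submodule (ZMod 2) (Fin n → ZMod 2)) (y : Fin n → ZMod 2) :
    (2 : ℤ) ^ wt y ∣ ∑ x ∈ Finset.univ.filter
      (fun x : Fin n → ZMod 2 => ∀ i, x i * y i = x i), fourierRestrict f Γ x := by
  simp only [fourierRestrict]
  rw [Finset.sum_comm]
  simp only [neg_one_pow_val_add, ← Finset.mul_sum]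
  exact Finset.dvd_sum fun u _ => (two_pow_wt_dvd_sum_subcube u y).mul_left _

theorem exists_fourierRestrict_eq {n : ℕ} {f : (Fin n → ZMod 2) → ZMod 2} (hf : IsBent f)
    {Γ : Submodule (ZMod 2) (Fin n → ZMod 2)} {v : Fin n → ZMod 2}
    (hv : ∀ x, x ∈ Γ ↔ ip x v = 0) (y : Fin n → ZMod 2) :
    ∃ t : ℤ, fourierRestrict f Γ y = 2 ^ (n / 2) * t ∧
      (t : ZMod 2) = if fourierRestrict f Γ y ≠ 0 then 1 else 0 := by
  have h2 := two_mul_fourierRestrict f hv y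
  have hpos : (0 : ℤ) < 2 ^ (n / 2) := by positivity
  have hcases : fourierRestrict f Γ y = 2 ^ (n / 2) ∨ fourierRestrict f Γ y = 0 ∨
      fourierRestrict f Γ y = -2 ^ (n / 2) := by
    rcases hf y with h | h <;> rcases hf (y + v) with h' | h' <;> rw [h, h'] at h2 <;> omega
  rcases hcases with h | h | h
  · exact ⟨1, by simp [h]⟩
  · exact ⟨0, by simp [h]⟩
  · exact ⟨-1, by simp [h]⟩

/-- For a bent function `f` and a linear hyperplane `Γ`, the support indicator of the
Fourier transform of `(-1)^f·1_Γ`, i.e. `h(y) = 1 ↔ ∑_{x ∈ Γ} (-1)^{f(x)⊕⟨x,y⟩} ≠ 0`,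
has algebraic degree at most `n/2`. -/
theorem degree_support_fourier_restrict_le (n : ℕ) (he : n % 2 = 0)
    (f : (Fin n → ZMod 2) → ZMod 2) (hf : IsBent f)
    (Γ : Submodule (ZMod 2) (Fin n → ZMod 2))
    (hΓ : Module.finrank (ZMod 2) Γ = n - 1) :
    degree (fun y : Fin n → ZMod 2 =>
      if (∑ x ∈ Finset.univ.filter (fun x : Fin n → ZMod 2 => x ∈ Γ),
          (-1 : ℤ) ^ (f x + ip x y).val) ≠ 0 then 1 else 0) ≤ n / 2 := by
  obtain ⟨v, hv⟩ := exists_mem_iff_ip_eq_zero Γ hΓ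
  choose t ht hpar using exists_fourierRestrict_eq hf hv
  refine Finset.sup_le fun y hy => ?_
  by_contra! hlt
  have hone := (Finset.mem_filter.1 hy).2
  change ∑ x ∈ Finset.univ.filter (fun x : Fin n → ZMod 2 => ∀ i, x i * y i = x i),
    (if fourierRestrict f Γ x ≠ 0 then (1 : ZMod 2) else 0) = 1 at hone
  have hdvd := (pow_dvd_pow (2 : ℤ) hlt).trans (two_pow_wt_dvd_sum_fourierRestrict f Γ y)
  simp only [ht, ← Finset.mul_sum] at hdvd
  rw [pow_succ] at hdvd
  have heven := Int.dvd_of_mul_dvd_mul_left (by positivity) hdvd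
  have hzero := (ZMod.intCast_zmod_eq_zero_iff_dvd _ 2).2 heven
  simp only [← hpar] at hone
  rw [Int.cast_sum, hone] at hzero
  exact one_ne_zero hzero
end

section
/- Fix an integer s ≥ 0. For every ε > 0 there exists N such that for all n ≥ N with n + s even, the binary logarithm 𝒩(n,s) of the number of s-plateaued Boolean functions in n variables satisfies 𝒩(n,s) ≤ (1 + ε)·2ⁿ·(ℏ(1/2^s) + 1/2^s). -/
/-- `f` is `s`-plateaued: all Walsh coefficients lie in `{0, ±2^((n+s)/2)}`. -/
def IsPlateaued {n : ℕ} (s : ℕ) (f : (Fin n → ZMod 2) → ZMod 2) : Prop :=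
  ∀ y, walsh f y = 0 ∨ walsh f y = 2 ^ ((n + s) / 2) ∨ walsh f y = -2 ^ ((n + s) / 2)

/-- Shannon's binary entropy function (with the conventions `ℏ(0) = ℏ(1) = 0`,
since `Real.logb 2 0 = 0`). -/
noncomputable def binEnt (p : ℝ) : ℝ :=
  -p * Real.logb 2 p - (1 - p) * Real.logb 2 (1 - p)

/-- `𝒩(n,s)`: the binary logarithm of the number of `s`-plateaued Boolean functions
in `n` variables. -/
noncomputable def logNumPlateaued (n s : ℕ) : ℝ :=
  Real.logb 2 (Nat.card {f : (Fin n → ZMod 2) → ZMod 2 // IsPlateaued s f})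

/-- The nontrivial additive character of `ZMod 2`, with integer values. -/
def signChar (a : ZMod 2) : ℤ := (-1) ^ a.val

lemma signChar_add (a b : ZMod 2) : signChar (a + b) = signChar a * signChar b := by
  revert a b; decide

lemma signChar_mul_self (a : ZMod 2) : signChar a * signChar a = 1 := by
  revert a; decide

lemma signChar_injective : Function.Injective signChar := by
  unfold Function.Injective; decide

lemma signChar_sum {ι : Type*} (t : Finset ι) (a : ι → ZMod 2) :
    signChar (∑ i ∈ t, a i) = ∏ i ∈ t, signChar (a i) := by
  classical
  induction t using Finset.induction_on with
  | empty => simp [signChar]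
  | insert i t hi ih => rw [Finset.sum_insert hi, Finset.prod_insert hi, signChar_add, ih]

lemma sum_signChar_mul (a b : ZMod 2) :
    ∑ c, signChar (a * c) * signChar (b * c) = if a = b then 2 else 0 := by
  revert a b; decide

lemma sum_signChar_ip {n : ℕ} (x z : Fin n → ZMod 2) :
    ∑ y, signChar (ip x y) * signChar (ip z y) = if x = z then 2 ^ n else 0 := by
  have h : ∀ y : Fin n → ZMod 2, signChar (ip x y) * signChar (ip z y) =
      ∏ i, signChar (x i * y i) * signChar (z i * y i) := fun y => by
    rw [ip, ip, signChar_sum, signChar_sum, Finset.prod_mul_distrib]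
  simp_rw [h]
  rw [← Fintype.prod_sum (fun i c => signChar (x i * c) * signChar (z i * c))]
  simp_rw [sum_signChar_mul]
  split_ifs with hxz
  · simp [hxz]
  · obtain ⟨i, hi⟩ := Function.ne_iff.mp hxz
    exact Finset.prod_eq_zero (Finset.mem_univ i) (if_neg hi)

lemma walsh_eq_sum_signChar {n : ℕ} (f : (Fin n → ZMod 2) → ZMod 2) (y : Fin n → ZMod 2) :
    walsh f y = ∑ x, signChar (f x) * signChar (ip x y) :=
  Finset.sum_congr rfl fun x _ => signChar_add (f x) (ip x y)

/-- Fourier inversion for the Walsh–Hadamard transform. -/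
lemma sum_walsh_mul_signChar {n : ℕ} (f : (Fin n → ZMod 2) → ZMod 2) (z : Fin n → ZMod 2) :
    ∑ y, walsh f y * signChar (ip z y) = 2 ^ n * signChar (f z) := by
  simp_rw [walsh_eq_sum_signChar, Finset.sum_mul]
  rw [Finset.sum_comm]
  simp_rw [mul_assoc, ← Finset.mul_sum, sum_signChar_ip]
  simp [mul_comm]

lemma walsh_injective {n : ℕ} :
    Function.Injective (walsh : ((Fin n → ZMod 2) → ZMod 2) → (Fin n → ZMod 2) → ℤ) := by
  intro f g h
  funext z
  apply signChar_injective
  have hz := sum_walsh_mul_signChar f z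
  rw [h, sum_walsh_mul_signChar] at hz
  exact (mul_left_cancel₀ (by positivity) hz).symm

/-- Parseval's identity for the Walsh–Hadamard transform. -/
lemma sum_walsh_sq {n : ℕ} (f : (Fin n → ZMod 2) → ZMod 2) :
    ∑ y, walsh f y ^ 2 = 2 ^ n * 2 ^ n := by
  have h : ∀ y, walsh f y ^ 2 =
      ∑ x, signChar (f x) * (walsh f y * signChar (ip x y)) := fun y => by
    rw [sq]
    nth_rewrite 2 [walsh_eq_sum_signChar]
    rw [Finset.mul_sum]
    exact Finset.sum_congr rfl fun x _ => by ring
  simp_rw [h]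
  rw [Finset.sum_comm]
  simp_rw [← Finset.mul_sum, sum_walsh_mul_signChar,
    fun x => mul_left_comm (signChar (f x)) (2 ^ n) (signChar (f x)), signChar_mul_self]
  simp

/-- The support of the Walsh–Hadamard transform. -/
def walshSupport {n : ℕ} (f : (Fin n → ZMod 2) → ZMod 2) : Finset (Fin n → ZMod 2) :=
  {y | walsh f y ≠ 0}

/-- The set where the Walsh–Hadamard transform is positive. -/
def walshPos {n : ℕ} (f : (Fin n → ZMod 2) → ZMod 2) : Finset (Fin n → ZMod 2) :=
  {y | 0 < walsh f y}

lemma IsPlateaued.card_walshSupport {n s : ℕ} {f : (Fin n → ZMod 2) → ZMod 2}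
    (hf : IsPlateaued s f) (hsn : s ≤ n) (hpar : (n + s) % 2 = 0) :
    (walshSupport f).card = 2 ^ (n - s) := by
  have hexp : (n + s) / 2 * 2 = n + s := by omega
  have hsq : ∀ y, walsh f y ^ 2 = if walsh f y ≠ 0 then 2 ^ (n + s) else 0 := fun y => by
    have hpos : (2 : ℤ) ^ ((n + s) / 2) ≠ 0 := by positivity
    rcases hf y with h | h | h
    · simp [h]
    · rw [h, if_pos hpos, ← pow_mul, hexp]
    · rw [h, if_pos (neg_ne_zero.mpr hpos), neg_sq, ← pow_mul, hexp]
  have key := sum_walsh_sq f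
  simp_rw [hsq] at key
  rw [← Finset.sum_filter, Finset.sum_const, nsmul_eq_mul] at key
  have hpow : (2 : ℤ) ^ n * 2 ^ n = 2 ^ (n - s) * 2 ^ (n + s) := by
    rw [← pow_add, ← pow_add]; congr 1; omega
  rw [hpow] at key
  exact_mod_cast mul_right_cancel₀ (by positivity) key

lemma IsPlateaued.eq_of_walshSupport_eq {n s : ℕ} {f g : (Fin n → ZMod 2) → ZMod 2}
    (hf : IsPlateaued s f) (hg : IsPlateaued s g) (hsupp : walshSupport f = walshSupport g)
    (hpos : walshPos f = walshPos g) : f = g := by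
  apply walsh_injective
  funext y
  have h₁ := congrArg (y ∈ ·) hsupp
  have h₂ := congrArg (y ∈ ·) hpos
  simp only [walshSupport, walshPos, Finset.mem_filter, Finset.mem_univ, true_and,
    eq_iff_iff] at h₁ h₂
  have h0 : (0 : ℤ) < 2 ^ ((n + s) / 2) := by positivity
  rcases hf y with h | h | h <;> rcases hg y with h' | h' | h' <;> rw [h, h'] at h₁ h₂ <;>
    rw [h, h'] <;> grind

lemma card_isPlateaued_le {n s : ℕ} (hsn : s ≤ n) (hpar : (n + s) % 2 = 0) :
    Nat.card {f : (Fin n → ZMod 2) → ZMod 2 // IsPlateaued s f} ≤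
      (2 ^ n).choose (2 ^ (n - s)) * 2 ^ 2 ^ (n - s) := by
  classical
  let T : Finset (Σ _ : Finset (Fin n → ZMod 2), Finset (Fin n → ZMod 2)) :=
    (Finset.univ.powersetCard (2 ^ (n - s))).sigma fun S => S.powerset
  have hT : T.card = (2 ^ n).choose (2 ^ (n - s)) * 2 ^ 2 ^ (n - s) := by
    rw [Finset.card_sigma, Finset.sum_congr rfl (g := fun _ => 2 ^ 2 ^ (n - s))
      fun S hS => by rw [Finset.card_powerset, (Finset.mem_powersetCard.mp hS).2]]
    simp [ZMod.card]
  rw [← hT, ← Nat.card_eq_finsetCard]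
  refine Nat.card_le_card_of_injective
    (fun f => ⟨⟨walshSupport f.1, walshPos f.1⟩, ?_⟩) fun f g hfg => ?_
  · simp only [T, Finset.mem_sigma, Finset.mem_powersetCard,
      Finset.mem_powerset]
    refine ⟨⟨Finset.subset_univ _, f.2.card_walshSupport hsn hpar⟩, fun y hy => ?_⟩
    simp only [walshSupport, walshPos, Finset.mem_filter, Finset.mem_univ, true_and] at hy ⊢
    exact hy.ne'
  · simp only [Subtype.mk.injEq, Sigma.mk.injEq, heq_eq_eq] at hfg
    exact Subtype.ext (f.2.eq_of_walshSupport_eq g.2 hfg.1 hfg.2)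

/-- The entropy bound on binomial coefficients. -/
lemma logb_choose_le_mul_binEnt {N K : ℕ} {p : ℝ} (hK : 0 < K) (hKN : K ≤ N) (hp : K = N * p) :
    Real.logb 2 (N.choose K) ≤ N * binEnt p := by
  have hN : (0 : ℝ) < N := by exact_mod_cast hK.trans_le hKN
  have hKpos : (0 : ℝ) < K := by exact_mod_cast hK
  have hKN' : (K : ℝ) ≤ N := by exact_mod_cast hKN
  have hp0 : 0 < p := by
    rw [hp] at hKpos
    exact pos_of_mul_pos_right hKpos hN.le
  have hp1 : 0 ≤ 1 - p := by nlinarith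
  have hC : (0 : ℝ) < N.choose K := by exact_mod_cast Nat.choose_pos hKN
  have hq : (0 : ℝ) < (1 - p) ^ (N - K) := by
    rcases hp1.eq_or_lt with h | h
    · have : (K : ℝ) = N := by rw [hp, show p = 1 by linarith, mul_one]
      have : K = N := by exact_mod_cast this
      simp [this]
    · positivity
  have hle : p ^ K * (1 - p) ^ (N - K) * N.choose K ≤ 1 := by
    have hsum := add_pow p (1 - p) N
    rw [add_sub_cancel, one_pow] at hsum
    refine le_of_le_of_eq ?_ hsum.symm
    exact Finset.single_le_sum (f := fun m => p ^ m * (1 - p) ^ (N - m) * (N.choose m : ℝ))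
      (fun m _ => by positivity) (Finset.mem_range.mpr (by omega))
  have hlog := Real.logb_nonpos (b := 2) (by norm_num) (by positivity) hle
  rw [Real.logb_mul (by positivity) hC.ne', Real.logb_mul (by positivity) hq.ne',
    Real.logb_pow, Real.logb_pow, Nat.cast_sub hKN, hp] at hlog
  unfold binEnt
  linarith

lemma binEnt_nonneg {p : ℝ} (h0 : 0 ≤ p) (h1 : p ≤ 1) : 0 ≤ binEnt p := by
  have ha := mul_nonpos_of_nonneg_of_nonpos h0 (Real.logb_nonpos (b := 2) (by norm_num) h0 h1)
  have hb := mul_nonpos_of_nonneg_of_nonpos (sub_nonneg.mpr h1)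
    (Real.logb_nonpos (b := 2) (by norm_num) (sub_nonneg.mpr h1) (by linarith))
  unfold binEnt
  linarith

/-- The entropy bound holds without the error factor as soon as `s ≤ n`. -/
lemma logNumPlateaued_le {n s : ℕ} (hsn : s ≤ n) (hpar : (n + s) % 2 = 0) :
    logNumPlateaued n s ≤ 2 ^ n * (binEnt (1 / 2 ^ s) + 1 / 2 ^ s) := by
  have hpow : (2 : ℝ) ^ (n - s) = 2 ^ n * (1 / 2 ^ s) := by
    rw [pow_sub₀ _ two_ne_zero hsn, one_div]
  have hle : 2 ^ (n - s) ≤ 2 ^ n := Nat.pow_le_pow_right two_pos (Nat.sub_le n s)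
  have hchoose := logb_choose_le_mul_binEnt (N := 2 ^ n) (K := 2 ^ (n - s)) (p := 1 / 2 ^ s)
    (by positivity) hle (by exact_mod_cast hpow)
  push_cast at hchoose
  have hC : (0 : ℝ) < (2 ^ n).choose (2 ^ (n - s)) := by exact_mod_cast Nat.choose_pos hle
  have hbound : Real.logb 2 (((2 ^ n).choose (2 ^ (n - s)) * 2 ^ 2 ^ (n - s) : ℕ) : ℝ) ≤
      2 ^ n * (binEnt (1 / 2 ^ s) + 1 / 2 ^ s) := by
    push_cast
    rw [Real.logb_mul hC.ne' (by positivity), Real.logb_pow, Real.logb_self_eq_one (by norm_num),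
      mul_add]
    push_cast
    linarith
  rcases (Nat.card {f : (Fin n → ZMod 2) → ZMod 2 // IsPlateaued s f}).eq_zero_or_pos with h | h
  · rw [logNumPlateaued, h, Nat.cast_zero, Real.logb_zero]
    have hs : (1 : ℝ) / 2 ^ s ≤ 1 := by
      rw [div_le_one (by positivity)]
      exact one_le_pow₀ one_le_two
    have := binEnt_nonneg (by positivity) hs
    positivity
  · refine le_trans (Real.logb_le_logb_of_le (by norm_num) (by exact_mod_cast h) ?_) hbound
    exact_mod_cast card_isPlateaued_le hsn hpar

/-- Asymptotic upper bound `𝒩(n,s) ≤ 2ⁿ(ℏ(1/2^s) + 1/2^s)(1 + o(1))`. -/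
theorem logNumPlateaued_le_entropy_bound (s : ℕ) :
    ∀ ε > (0 : ℝ), ∃ N : ℕ, ∀ n ≥ N, (n + s) % 2 = 0 →
      logNumPlateaued n s ≤ (1 + ε) * 2 ^ n * (binEnt (1 / 2 ^ s) + 1 / 2 ^ s) := by
  intro ε hε
  refine ⟨s, fun n hn hpar => (logNumPlateaued_le hn hpar).trans ?_⟩
  have hs : (1 : ℝ) / 2 ^ s ≤ 1 := by
    rw [div_le_one (by positivity)]
    exact one_le_pow₀ one_le_two
  have := binEnt_nonneg (by positivity) hs
  rw [mul_assoc]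
  exact le_mul_of_one_le_left (by positivity) (by linarith)
end

section
/- Fix an integer s > 0 and let α = 1 + (3/8)·log₂ 6. For every ε > 0 there exists N such that for all n ≥ N with n + s even, the binary logarithm 𝒩(n,s) of the number of s-plateaued Boolean functions in n variables satisfies 𝒩(n,s) ≤ (1 + ε)·(α·b(n−2, ⌈(n−s)/2⌉ + 1) + 2^{n−2}·(ℏ(1/2^s) + 1/2^s)). -/
/-- `b(n,r) = ∑_{i=0}^{r} C(n,i)`: the cardinality of a Hamming ball of radius `r`
in 𝔽₂ⁿ. -/
def ballCard (n r : ℕ) : ℕ := ∑ i ∈ Finset.range (r + 1), n.choose i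

/-- The sign character `ZMod 2 → {1, -1}`. -/
def sgn (a : ZMod 2) : ℤ := (-1) ^ a.val

lemma sgn_zero : sgn 0 = 1 := rfl

lemma sgn_add (a b : ZMod 2) : sgn (a + b) = sgn a * sgn b := by
  revert a b; decide

lemma sgn_mul_self (a : ZMod 2) : sgn a * sgn a = 1 := by
  revert a; decide

lemma sgn_eq (a : ZMod 2) : sgn a = 1 - 2 * (a.val : ℤ) := by
  revert a; decide

lemma sgn_sum {ι : Type*} (s : Finset ι) (a : ι → ZMod 2) :
    sgn (∑ i ∈ s, a i) = ∏ i ∈ s, sgn (a i) := by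
  classical
  induction s using Finset.induction_on with
  | empty => simp [sgn_zero]
  | insert i s hi ih => rw [Finset.sum_insert hi, Finset.prod_insert hi, sgn_add, ih]

lemma ip_add_left {n : ℕ} (x x' y : Fin n → ZMod 2) : ip (x + x') y = ip x y + ip x' y := by
  simp [ip, add_mul, Finset.sum_add_distrib]

lemma ip_sum_left {n : ℕ} {ι : Type*} (s : Finset ι) (e : ι → Fin n → ZMod 2)
    (y : Fin n → ZMod 2) : ip (∑ i ∈ s, e i) y = ∑ i ∈ s, ip (e i) y := by
  simp only [ip, Finset.sum_apply, Finset.sum_mul]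
  exact Finset.sum_comm

lemma ip_append {k m : ℕ} (u z : Fin k → ZMod 2) (w y : Fin m → ZMod 2) :
    ip (Fin.append u w) (Fin.append z y) = ip u z + ip w y := by
  simp [ip, Fin.sum_univ_add]

/-- Unnormalised Fourier transform on `𝔽₂ⁿ`. -/
def boolFourier {n : ℕ} (g : (Fin n → ZMod 2) → ℤ) (y : Fin n → ZMod 2) : ℤ :=
  ∑ x, g x * sgn (ip x y)

lemma walsh_eq_boolFourier {n : ℕ} (f : (Fin n → ZMod 2) → ZMod 2) (y : Fin n → ZMod 2) :
    walsh f y = boolFourier (fun x => sgn (f x)) y := by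
  simp only [boolFourier, ← sgn_add]; rfl

lemma sum_sgn_ip {n : ℕ} (x : Fin n → ZMod 2) :
    ∑ y, sgn (ip x y) = if x = 0 then 2 ^ n else 0 := by
  have h : ∑ y, sgn (ip x y) = ∏ i, ∑ t : ZMod 2, sgn (x i * t) := by
    rw [Finset.prod_univ_sum]
    simp [ip, sgn_sum]
  have h2 : ∀ a : ZMod 2, ∑ t : ZMod 2, sgn (a * t) = if a = 0 then 2 else 0 := by decide
  rw [h]
  simp only [h2]
  split_ifs with hx
  · simp [hx]
  · obtain ⟨i, hi⟩ := Function.ne_iff.1 hx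
    exact Finset.prod_eq_zero (Finset.mem_univ i) (by simpa using hi)

lemma add_eq_zero_iff_eq_zmod_two {n : ℕ} (x y : Fin n → ZMod 2) : x + y = 0 ↔ x = y := by
  have h : ∀ a b : ZMod 2, a + b = 0 ↔ a = b := by decide
  simp only [funext_iff, Pi.add_apply, Pi.zero_apply, h]

lemma boolFourier_inversion {n : ℕ} (g : (Fin n → ZMod 2) → ℤ) (x : Fin n → ZMod 2) :
    ∑ y, boolFourier g y * sgn (ip x y) = 2 ^ n * g x := by
  simp only [boolFourier, Finset.sum_mul]
  rw [Finset.sum_comm]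
  simp only [mul_assoc, ← sgn_add, ← ip_add_left, ← Finset.mul_sum, sum_sgn_ip,
    add_eq_zero_iff_eq_zmod_two]
  simp [mul_comm]

lemma boolFourier_parseval {n : ℕ} (g : (Fin n → ZMod 2) → ℤ) :
    ∑ y, boolFourier g y ^ 2 = 2 ^ n * ∑ x, g x ^ 2 := by
  have h : ∀ y, boolFourier g y ^ 2 = ∑ x, g x * (boolFourier g y * sgn (ip x y)) := by
    intro y
    rw [sq]
    nth_rw 1 [boolFourier]
    rw [Finset.sum_mul]
    exact Finset.sum_congr rfl fun x _ => by ring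
  simp only [h]
  rw [Finset.sum_comm, Finset.mul_sum]
  refine Finset.sum_congr rfl fun x _ => ?_
  rw [← Finset.mul_sum, boolFourier_inversion]; ring

/-- A Boolean function whose Walsh coefficients are divisible by `2 ^ k` has even weight on
parallelepipeds of large dimension. -/
lemma sum_powerset_eq_zero {n k : ℕ} {ι : Type*} {f : (Fin n → ZMod 2) → ZMod 2}
    (hf : ∀ y, (2 : ℤ) ^ k ∣ walsh f y) (x₀ : Fin n → ZMod 2) (e : ι → Fin n → ZMod 2)
    (I : Finset ι) (hI : 2 ≤ I.card) (hk : n + 2 ≤ I.card + k) :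
    ∑ J ∈ I.powerset, f (x₀ + ∑ i ∈ J, e i) = 0 := by
  classical
  set S : ℤ := ∑ J ∈ I.powerset, sgn (f (x₀ + ∑ i ∈ J, e i)) with hS
  have h1 : 2 ^ n * S =
      ∑ y, walsh f y * (sgn (ip x₀ y) * ∏ i ∈ I, (1 + sgn (ip (e i) y))) := by
    simp only [Finset.prod_one_add, hS, Finset.mul_sum]
    rw [Finset.sum_comm]
    refine Finset.sum_congr rfl fun J _ => ?_
    rw [← boolFourier_inversion (fun x => sgn (f x))]
    simp only [walsh_eq_boolFourier, ip_add_left, ip_sum_left, sgn_add, sgn_sum]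
  have h2 : (2 : ℤ) ^ (n + 2) ∣ 2 ^ n * S := by
    rw [h1]
    refine Finset.dvd_sum fun y _ => (pow_dvd_pow 2 hk).trans ?_
    rw [pow_add, mul_comm]
    refine mul_dvd_mul (hf y) (Dvd.dvd.mul_left ?_ _)
    rw [← Finset.prod_const]
    refine Finset.prod_dvd_prod_of_dvd _ _ fun i _ => ?_
    rw [sgn_eq]
    exact ⟨1 - ((ip (e i) y).val : ℤ), by ring⟩
  have h3 : (4 : ℤ) ∣ S := by
    rw [pow_add] at h2
    exact (mul_dvd_mul_iff_left (by positivity)).1 h2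
  have h4 : S = 2 ^ I.card - 2 * ∑ J ∈ I.powerset, ((f (x₀ + ∑ i ∈ J, e i)).val : ℤ) := by
    simp [hS, sgn_eq, Finset.sum_sub_distrib, Finset.mul_sum]
  have h5 : (4 : ℤ) ∣ 2 ^ I.card := pow_dvd_pow 2 hI
  have h6 : (2 : ℤ) ∣ ∑ J ∈ I.powerset, ((f (x₀ + ∑ i ∈ J, e i)).val : ℤ) := by omega
  have h7 := (ZMod.intCast_zmod_eq_zero_iff_dvd _ 2).2 h6
  simpa using h7

/-- The indicator vector of a set of coordinates. -/
def indVec {m : ℕ} (J : Finset (Fin m)) : Fin m → ZMod 2 := ∑ i ∈ J, Pi.single i 1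

lemma indVec_apply {m : ℕ} (J : Finset (Fin m)) (i : Fin m) :
    indVec J i = if i ∈ J then 1 else 0 := by
  simp [indVec, Finset.sum_apply, Pi.single_apply]

lemma indVec_bijective {m : ℕ} : Function.Bijective (indVec (m := m)) := by
  constructor
  · intro I J h
    ext i
    have := congrFun h i
    simp only [indVec_apply] at this
    by_cases h1 : i ∈ I <;> by_cases h2 : i ∈ J <;> simp_all
  · intro w
    refine ⟨Finset.univ.filter fun i => w i = 1, ?_⟩
    ext i : 1
    rw [indVec_apply]
    have h : ∀ a : ZMod 2, (if a = 1 then (1 : ZMod 2) else 0) = a := by decide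
    simpa using h (w i)

/-- The Hamming ball, as a family of coordinate sets. -/
def ballSets (m r : ℕ) : Finset (Finset (Fin m)) := Finset.univ.filter fun J => J.card ≤ r

lemma card_ballSets (m r : ℕ) : (ballSets m r).card = ballCard m r := by
  rw [ballCard, Finset.card_eq_sum_card_fiberwise (f := Finset.card) (t := Finset.range (r + 1))]
  · refine Finset.sum_congr rfl fun i hi => ?_
    have hi' : i ≤ r := by simpa [Nat.lt_succ_iff] using hi
    have : (ballSets m r).filter (fun J => J.card = i) = Finset.powersetCard i Finset.univ := by
      ext J
      simp only [ballSets, Finset.mem_filter, Finset.mem_univ, true_and,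
        Finset.mem_powersetCard_univ]
      omega
    rw [this, Finset.card_powersetCard, Finset.card_univ, Fintype.card_fin]
  · intro J hJ
    simp only [ballSets, Finset.coe_filter, Finset.mem_univ, true_and, Set.mem_ofPred_eq] at hJ
    simpa [Nat.lt_succ_iff] using hJ

lemma append_add_sum {k m : ℕ} (u : Fin k → ZMod 2) (v : Fin m → ZMod 2)
    (J : Finset (Fin m)) :
    Fin.append u (v + indVec J) =
      Fin.append u v + ∑ i ∈ J, Fin.append (0 : Fin k → ZMod 2) (Pi.single i 1) := by
  ext i : 1
  refine Fin.addCases (fun i => ?_) (fun i => ?_) i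
  · simp [Finset.sum_apply]
  · simp [Finset.sum_apply, indVec]

/-- Functions with highly divisible Walsh coefficients are determined by their values over a
Hamming ball with arbitrary centre. -/
lemma eq_of_eq_on_ball {k m a r : ℕ} {f₁ f₂ : (Fin (k + m) → ZMod 2) → ZMod 2}
    (h₁ : ∀ y, (2 : ℤ) ^ a ∣ walsh f₁ y) (h₂ : ∀ y, (2 : ℤ) ^ a ∣ walsh f₂ y)
    (hr : 1 ≤ r) (ha : k + m + 2 ≤ r + 1 + a) (v : Fin m → ZMod 2)
    (h : ∀ J ∈ ballSets m r, ∀ u,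
      f₁ (Fin.append u (v + indVec J)) = f₂ (Fin.append u (v + indVec J))) : f₁ = f₂ := by
  have key : ∀ (I : Finset (Fin m)) (u : Fin k → ZMod 2),
      f₁ (Fin.append u (v + indVec I)) = f₂ (Fin.append u (v + indVec I)) := by
    intro I
    induction I using Finset.strongInduction with
    | H I ih =>
      intro u
      by_cases hI : I.card ≤ r
      · exact h I (by simpa [ballSets] using hI) u
      · have e₁ := sum_powerset_eq_zero h₁ (Fin.append u v)
          (fun i => Fin.append (0 : Fin k → ZMod 2) (Pi.single i 1)) I (by omega) (by omega)
        have e₂ := sum_powerset_eq_zero h₂ (Fin.append u v)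
          (fun i => Fin.append (0 : Fin k → ZMod 2) (Pi.single i 1)) I (by omega) (by omega)
        simp only [← append_add_sum] at e₁ e₂
        rw [← Finset.add_sum_erase _ _ (Finset.mem_powerset_self I)] at e₁ e₂
        have e₃ : ∑ J ∈ I.powerset.erase I, f₁ (Fin.append u (v + indVec J)) =
            ∑ J ∈ I.powerset.erase I, f₂ (Fin.append u (v + indVec J)) := by
          refine Finset.sum_congr rfl fun J hJ => ih J ?_ u
          rw [Finset.mem_erase, Finset.mem_powerset] at hJ
          exact lt_of_le_of_ne hJ.2 hJ.1
        rw [e₃] at e₁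
        exact add_right_cancel (e₁.trans e₂.symm)
  ext x
  obtain ⟨I, hI⟩ := indVec_bijective.2 ((fun i => x (Fin.natAdd k i)) - v)
  have hx : x = Fin.append (fun i => x (Fin.castAdd m i)) (v + indVec I) := by
    rw [hI, add_sub_cancel]
    exact (Fin.append_castAdd_natAdd).symm
  rw [hx, key]

lemma sum_append {k m : ℕ} {M : Type*} [AddCommMonoid M] (F : (Fin (k + m) → ZMod 2) → M) :
    ∑ x, F x = ∑ u : Fin k → ZMod 2, ∑ w : Fin m → ZMod 2, F (Fin.append u w) := by
  rw [← (Fin.appendEquiv k m).sum_comp, Fintype.sum_prod_type]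
  rfl

lemma sum_fin_two_arrow {M : Type*} [AddCommMonoid M] (F : (Fin 2 → ZMod 2) → M) :
    ∑ u, F u = F ![0, 0] + F ![0, 1] + (F ![1, 0] + F ![1, 1]) := by
  have h : ∀ G : ZMod 2 → M, ∑ t, G t = G 0 + G 1 := fun G => Fin.sum_univ_two G
  rw [← (finTwoArrowEquiv (ZMod 2)).symm.sum_comp, Fintype.sum_prod_type, h, h, h]
  rfl

lemma IsPlateaued.comp_linearEquiv {n s : ℕ} {f : (Fin n → ZMod 2) → ZMod 2}
    (hf : IsPlateaued s f) (A : (Fin n → ZMod 2) ≃ₗ[ZMod 2] (Fin n → ZMod 2)) :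
    IsPlateaued s (f ∘ A) := by
  intro y
  let l : (Fin n → ZMod 2) →ₗ[ZMod 2] ZMod 2 :=
    { toFun := fun x => ip x y
      map_add' := fun x x' => ip_add_left x x' y
      map_smul' := fun c x => by simp [ip, Finset.mul_sum, mul_assoc] }
  set y' : Fin n → ZMod 2 := fun i => l (A.symm (fun j => if i = j then 1 else 0)) with hy'
  have h : ∀ x, ip (A x) y' = ip x y := by
    intro x
    have := LinearMap.pi_apply_eq_sum_univ (l ∘ₗ A.symm.toLinearMap) (A x)
    simp only [LinearMap.comp_apply, LinearEquiv.coe_coe, LinearEquiv.symm_apply_apply] at this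
    exact this.symm
  have e : walsh (f ∘ A) y = walsh f y' := by
    unfold walsh
    rw [← A.toEquiv.sum_comp fun x => (-1 : ℤ) ^ (f x + ip x y').val]
    refine Finset.sum_congr rfl fun x _ => ?_
    simp only [LinearEquiv.coe_toEquiv, h, Function.comp_apply]
  rw [e]
  exact hf y'

lemma exists_linearEquiv_append {m : ℕ} {a b : Fin (2 + m) → ZMod 2}
    (hab : LinearIndependent (ZMod 2) ![a, b]) :
    ∃ A : (Fin (2 + m) → ZMod 2) ≃ₗ[ZMod 2] (Fin (2 + m) → ZMod 2),
      A (Fin.append ![1, 0] 0) = a ∧ A (Fin.append ![0, 1] 0) = b := by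
  obtain ⟨W, hW⟩ := Submodule.exists_isCompl (Submodule.span (ZMod 2) (Set.range ![a, b]))
  have hdim := Submodule.finrank_add_eq_of_isCompl hW
  rw [finrank_span_eq_card hab, Module.finrank_fin_fun, Fintype.card_fin] at hdim
  have hdim' : Module.finrank (ZMod 2) (Fin m → ZMod 2) = Module.finrank (ZMod 2) W := by
    rw [Module.finrank_fin_fun]; omega
  let B := Module.Basis.span hab
  let E : (Fin (2 + m) → ZMod 2) ≃ₗ[ZMod 2] ((Fin 2 → ZMod 2) × (Fin m → ZMod 2)) :=
    { (Fin.appendEquiv 2 m).symm with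
      map_add' := fun x y => rfl
      map_smul' := fun c x => rfl }
  let A := E ≪≫ₗ (B.equivFun.symm.prodCongr (LinearEquiv.ofFinrankEq _ _ hdim')) ≪≫ₗ
    Submodule.prodEquivOfIsCompl _ _ hW
  have hE : ∀ u w, E (Fin.append u w) = (u, w) := fun u w =>
    (Fin.appendEquiv 2 m).symm_apply_apply (u, w)
  have hA : ∀ u, A (Fin.append u 0) = u 0 • a + u 1 • b := by
    intro u
    simp [A, hE, Module.Basis.equivFun_symm_apply, B, Fin.sum_univ_two,
      Module.Basis.span_apply]
  exact ⟨A, by simp [hA], by simp [hA]⟩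

lemma zmod_two_linearIndependent_pair {n : ℕ} {a b : Fin n → ZMod 2} (ha : a ≠ 0) (hb : b ≠ 0)
    (hab : b ≠ a) : LinearIndependent (ZMod 2) ![a, b] := by
  rw [LinearIndependent.pair_iff' ha]
  intro c
  have hc : c = 0 ∨ c = 1 := by revert c; decide
  rcases hc with rfl | rfl
  · simpa using hb.symm
  · simpa using hab.symm

/-- The number of cosets of the plane spanned by the first two coordinates on which `f` has odd
weight. -/
def oddCosets {m : ℕ} (f : (Fin (2 + m) → ZMod 2) → ZMod 2) : ℕ :=
  ∑ w : Fin m → ZMod 2, (∑ u : Fin 2 → ZMod 2, f (Fin.append u w)).val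

lemma sum_derivative {m : ℕ} (f : (Fin (2 + m) → ZMod 2) → ZMod 2)
    {a b : Fin (2 + m) → ZMod 2}
    {A : (Fin (2 + m) → ZMod 2) ≃ₗ[ZMod 2] (Fin (2 + m) → ZMod 2)}
    (ha : A (Fin.append ![1, 0] 0) = a) (hb : A (Fin.append ![0, 1] 0) = b) :
    ∑ x, sgn (f x + f (x + a)) * sgn (f (x + b) + f (x + b + a)) =
      4 * (2 ^ m - 2 * (oddCosets (f ∘ A) : ℤ)) := by
  have h : ∀ u w, sgn (f (A (Fin.append u w)) + f (A (Fin.append u w) + a)) *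
      sgn (f (A (Fin.append u w) + b) + f (A (Fin.append u w) + b + a)) =
      sgn (∑ c : Fin 2 → ZMod 2, (f ∘ A) (Fin.append c w)) := by
    intro u w
    have e : ∑ c : Fin 2 → ZMod 2, (f ∘ A) (Fin.append c w) =
        ∑ c : Fin 2 → ZMod 2, (f ∘ A) (Fin.append (u + c) w) :=
      (Equiv.sum_comp (Equiv.addLeft u) fun c => (f ∘ A) (Fin.append c w)).symm
    have happ : ∀ c : Fin 2 → ZMod 2, Fin.append (u + c) w = Fin.append u w +
        (c 0 • Fin.append ![1, 0] 0 + c 1 • Fin.append ![0, 1] 0) := by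
      intro c
      ext i : 1
      refine Fin.addCases (fun i => ?_) (fun i => ?_) i
      · fin_cases i <;> simp
      · simp
    rw [e, sum_fin_two_arrow, ← sgn_add]
    simp only [Function.comp_apply, happ, map_add, map_smul, ha, hb]
    simp only [Matrix.cons_val_zero, Matrix.cons_val_one, zero_smul, one_smul, add_zero, zero_add]
    congr 1
    rw [show A (Fin.append u w) + b + a = A (Fin.append u w) + (a + b) by abel]
    ring
  rw [← A.toEquiv.sum_comp, sum_append]
  simp only [LinearEquiv.coe_toEquiv, h]
  simp only [sgn_eq, oddCosets, Finset.sum_sub_distrib, ← Finset.mul_sum]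
  simp
  ring

/-- After a suitable linear change of variables, at most half of the cosets of the plane spanned
by the first two coordinates have odd weight. -/
lemma exists_linearEquiv_oddCosets_le {m : ℕ} (hm : 1 ≤ m)
    (f : (Fin (2 + m) → ZMod 2) → ZMod 2) :
    ∃ A : (Fin (2 + m) → ZMod 2) ≃ₗ[ZMod 2] (Fin (2 + m) → ZMod 2),
      2 * oddCosets (f ∘ A) ≤ 2 ^ m := by
  by_contra! hcon
  set a : Fin (2 + m) → ZMod 2 := Pi.single (Fin.castAdd m 0) 1 with ha
  have ha0 : a ≠ 0 := by simp [ha]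
  set Q : (Fin (2 + m) → ZMod 2) → ℤ := fun x => sgn (f x + f (x + a)) with hQ
  set R : (Fin (2 + m) → ZMod 2) → ℤ := fun b => ∑ x, Q x * Q (x + b) with hR
  have hpos : 0 ≤ ∑ b, R b := by
    have : ∑ b, R b = (∑ x, Q x) * ∑ x, Q x := by
      simp only [hR]
      rw [Finset.sum_comm, Finset.sum_mul]
      refine Finset.sum_congr rfl fun x _ => ?_
      rw [← Finset.mul_sum, ← Equiv.sum_comp (Equiv.addLeft x) Q]
      rfl
    rw [this]; exact mul_self_nonneg _
  have hQa : ∀ x, Q (x + a) = Q x := by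
    intro x
    have : x + a + a = x := by
      rw [add_assoc, (add_eq_zero_iff_eq_zmod_two a a).2 rfl, add_zero]
    simp only [hQ, this, add_comm]
  have hcard : (Fintype.card (Fin (2 + m) → ZMod 2)) = 2 ^ (2 + m) := by simp
  have hR0 : R 0 = 2 ^ (2 + m) := by
    simp [hR, hQ, sgn_mul_self]
  have hRa : R a = 2 ^ (2 + m) := by
    simp only [hR, hQa]
    simp [hQ, sgn_mul_self]
  have hRb : ∀ b ∈ (Finset.univ.erase 0).erase a, R b ≤ -4 := by
    intro b hb
    simp only [Finset.mem_erase, Finset.mem_univ, and_true] at hb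
    obtain ⟨A, h1, h2⟩ :=
      exists_linearEquiv_append (zmod_two_linearIndependent_pair ha0 hb.2 hb.1)
    have h3 := sum_derivative f h1 h2
    have h4 : ((2 ^ m : ℕ) : ℤ) < ((2 * oddCosets (f ∘ A) : ℕ) : ℤ) := by exact_mod_cast hcon A
    push_cast at h4
    simp only [hR, hQ]
    rw [h3]
    omega
  have hsum : ∑ b, R b = R 0 + (R a + ∑ b ∈ (Finset.univ.erase 0).erase a, R b) := by
    rw [Finset.add_sum_erase _ _ (by simpa using ha0), Finset.add_sum_erase _ _ (by simp)]
  have hle := Finset.sum_le_card_nsmul _ _ _ hRb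
  rw [Finset.card_erase_of_mem (by simpa using ha0), Finset.card_erase_of_mem (by simp),
    Finset.card_univ, hcard] at hle
  have h8 : 8 ≤ 2 ^ (2 + m) := le_trans (by norm_num) (Nat.pow_le_pow_right (n := 2) (by norm_num)
    (show 3 ≤ 2 + m by omega))
  have h9 : (((2 ^ (2 + m) : ℕ)) : ℤ) = 2 ^ (2 + m) := by push_cast; rfl
  rw [nsmul_eq_mul, Nat.sub_sub, Nat.cast_sub (by omega), h9] at hle
  have h8' : (8 : ℤ) ≤ 2 ^ (2 + m) := by rw [← h9]; exact_mod_cast h8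
  push_cast at hle
  linarith

lemma card_walsh_fiber (t : (Fin 2 → ZMod 2) → ZMod 2) (z : Fin 2 → ZMod 2) :
    let c := (Finset.univ.filter fun t' : (Fin 2 → ZMod 2) → ZMod 2 =>
      walsh t' z = walsh t z).card
    let d := (∑ u, t u).val
    (d = 0 ∧ walsh t z ^ 2 = 0 ∧ c = 6) ∨ (d = 1 ∧ walsh t z ^ 2 = 4 ∧ c = 4) ∨
      (d = 0 ∧ walsh t z ^ 2 = 16 ∧ c = 1) := by
  revert t z; decide +kernel

/-- The logarithm of the number of Boolean functions in two variables with the same Walsh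
coefficient at `z` as `t`. -/
noncomputable def sliceCost (t : (Fin 2 → ZMod 2) → ZMod 2) (z : Fin 2 → ZMod 2) : ℝ :=
  2 * ((∑ u, t u).val : ℝ) +
    Real.logb 2 6 * (1 - 3 / 4 * ((∑ u, t u).val : ℝ) - (walsh t z : ℝ) ^ 2 / 16)

lemma card_walsh_fiber_le (t : (Fin 2 → ZMod 2) → ZMod 2) (z : Fin 2 → ZMod 2) :
    ((Finset.univ.filter fun t' : (Fin 2 → ZMod 2) → ZMod 2 =>
      walsh t' z = walsh t z).card : ℝ) ≤ 2 ^ sliceCost t z := by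
  have hw : ∀ k : ℤ, walsh t z ^ 2 = k → (walsh t z : ℝ) ^ 2 = k := by
    intro k hk; exact_mod_cast hk
  unfold sliceCost
  rcases card_walsh_fiber t z with ⟨h1, h2, h3⟩ | ⟨h1, h2, h3⟩ | ⟨h1, h2, h3⟩
  · rw [h1, hw _ h2, h3]
    norm_num
  · rw [h1, hw _ h2, h3]
    norm_num
  · rw [h1, hw _ h2, h3]
    norm_num

/-- The restriction of `f` to a coset of the plane spanned by the first two coordinates. -/
def planeSlice {m : ℕ} (f : (Fin (2 + m) → ZMod 2) → ZMod 2) (w : Fin m → ZMod 2) :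
    (Fin 2 → ZMod 2) → ZMod 2 := fun u => f (Fin.append u w)

lemma walsh_append {m : ℕ} (f : (Fin (2 + m) → ZMod 2) → ZMod 2) (z : Fin 2 → ZMod 2)
    (y : Fin m → ZMod 2) :
    walsh f (Fin.append z y) = boolFourier (fun w => walsh (planeSlice f w) z) y := by
  simp only [walsh_eq_boolFourier, boolFourier, planeSlice, Finset.sum_mul]
  rw [sum_append, Finset.sum_comm]
  simp only [ip_append, sgn_add, mul_assoc]

/-- The size of the Walsh support of `f` on a coset of a subspace of codimension two. -/
def cosetSupport {m : ℕ} (f : (Fin (2 + m) → ZMod 2) → ZMod 2) (z : Fin 2 → ZMod 2) : ℕ :=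
  (Finset.univ.filter fun y : Fin m → ZMod 2 => walsh f (Fin.append z y) ≠ 0).card

lemma IsPlateaued.sq_walsh {n s : ℕ} {f : (Fin n → ZMod 2) → ZMod 2}
    (hf : IsPlateaued s f) (hns : (n + s) % 2 = 0) (y : Fin n → ZMod 2) :
    walsh f y ^ 2 = if walsh f y ≠ 0 then 2 ^ (n + s) else 0 := by
  have h : ((2 : ℤ) ^ ((n + s) / 2)) ^ 2 = 2 ^ (n + s) := by
    rw [← pow_mul, Nat.div_mul_cancel (Nat.dvd_of_mod_eq_zero hns)]
  rcases hf y with h0 | h0 | h0 <;> simp [h0, h]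

lemma IsPlateaued.sum_sq_walsh_planeSlice {m s : ℕ} {f : (Fin (2 + m) → ZMod 2) → ZMod 2}
    (hf : IsPlateaued s f) (hns : (2 + m + s) % 2 = 0) (z : Fin 2 → ZMod 2) :
    ∑ w, walsh (planeSlice f w) z ^ 2 = cosetSupport f z * 2 ^ (2 + s) := by
  have h := boolFourier_parseval (fun w => walsh (planeSlice f w) z)
  simp only [← walsh_append, hf.sq_walsh hns] at h
  rw [← Finset.sum_filter, Finset.sum_const, nsmul_eq_mul] at h
  have h2 : (2 : ℤ) ^ m ≠ 0 := by positivity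
  apply mul_left_cancel₀ h2
  rw [← h, cosetSupport]
  ring

lemma sum_sq_walsh_two (t : (Fin 2 → ZMod 2) → ZMod 2) : ∑ z, walsh t z ^ 2 = 16 := by
  simp only [walsh_eq_boolFourier, boolFourier_parseval, sq (sgn _), sgn_mul_self]
  simp

lemma IsPlateaued.sum_cosetSupport {m s : ℕ} {f : (Fin (2 + m) → ZMod 2) → ZMod 2}
    (hf : IsPlateaued s f) (hns : (2 + m + s) % 2 = 0) :
    (∑ z, cosetSupport f z) * 2 ^ s = 4 * 2 ^ m := by
  have h : ∑ z, ∑ w, walsh (planeSlice f w) z ^ 2 = 2 ^ m * 16 := by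
    rw [Finset.sum_comm]
    simp [sum_sq_walsh_two]
  simp only [hf.sum_sq_walsh_planeSlice hns, ← Finset.sum_mul] at h
  have h2 : (((∑ z, cosetSupport f z) * 2 ^ s : ℕ) : ℤ) = ((4 * 2 ^ m : ℕ) : ℤ) := by
    push_cast
    rw [pow_add] at h
    linarith
  exact_mod_cast h2

/-- The sign pattern of the Walsh coefficients of `f` on a coset of a subspace of codimension
two. -/
noncomputable def walshPattern {m : ℕ} (f : (Fin (2 + m) → ZMod 2) → ZMod 2) (z : Fin 2 → ZMod 2)
    (y : Fin m → ZMod 2) : SignType := SignType.sign (walsh f (Fin.append z y))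

lemma IsPlateaued.walsh_eq_sign {n s : ℕ} {f : (Fin n → ZMod 2) → ZMod 2}
    (hf : IsPlateaued s f) (y : Fin n → ZMod 2) :
    walsh f y = SignType.sign (walsh f y) * 2 ^ ((n + s) / 2) := by
  have h : (0 : ℤ) < 2 ^ ((n + s) / 2) := by positivity
  rcases hf y with h0 | h0 | h0
  · simp [h0]
  · rw [h0, sign_pos h]; simp
  · rw [h0, sign_neg (by linarith)]; simp

lemma walsh_planeSlice_eq {m s : ℕ} {f f' : (Fin (2 + m) → ZMod 2) → ZMod 2}
    (hf : IsPlateaued s f) (hf' : IsPlateaued s f') {z : Fin 2 → ZMod 2}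
    (h : walshPattern f z = walshPattern f' z) (w : Fin m → ZMod 2) :
    walsh (planeSlice f w) z = walsh (planeSlice f' w) z := by
  have h1 := boolFourier_inversion (fun w => walsh (planeSlice f w) z) w
  have h2 := boolFourier_inversion (fun w => walsh (planeSlice f' w) z) w
  have h3 : ∀ y, walsh f (Fin.append z y) = walsh f' (Fin.append z y) := by
    intro y
    have := congrFun h y
    simp only [walshPattern] at this
    rw [hf.walsh_eq_sign, hf'.walsh_eq_sign, this]
  simp only [← walsh_append, h3] at h1 h2
  exact mul_left_cancel₀ (by positivity) (h1.symm.trans h2)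

/-- The probability weight on signs with mass `p / 2` at each of `1` and `-1`. -/
noncomputable def signWeight (p : ℝ) (t : SignType) : ℝ := if t = 0 then 1 - p else p / 2

lemma signWeight_pos {p : ℝ} (h0 : 0 < p) (h1 : p < 1) (t : SignType) : 0 < signWeight p t := by
  unfold signWeight; split_ifs <;> linarith

lemma sum_prod_signWeight (p : ℝ) (Y : Type*) [Fintype Y] [DecidableEq Y] :
    ∑ π : Y → SignType, ∏ y, signWeight p (π y) = 1 := by
  have h : ∑ t, signWeight p t = 1 := by
    have : (Finset.univ : Finset SignType) = {0, -1, 1} := rfl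
    rw [this]
    simp [signWeight]
  have := Finset.prod_univ_sum (fun _ : Y => (Finset.univ : Finset SignType))
    (fun _ t => signWeight p t)
  rw [Fintype.piFinset_univ] at this
  rw [← this]
  simp [h]

/-- The code length of the Walsh sign pattern of `f` on a coset. -/
noncomputable def patternCost {m : ℕ} (p : ℝ) (f : (Fin (2 + m) → ZMod 2) → ZMod 2)
    (z : Fin 2 → ZMod 2) : ℝ :=
  -∑ y, Real.logb 2 (signWeight p (walshPattern f z y))

lemma two_rpow_neg_patternCost {m : ℕ} {p : ℝ} (h0 : 0 < p) (h1 : p < 1)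
    (f : (Fin (2 + m) → ZMod 2) → ZMod 2) (z : Fin 2 → ZMod 2) :
    (2 : ℝ) ^ (-patternCost p f z) = ∏ y, signWeight p (walshPattern f z y) := by
  rw [patternCost, neg_neg, Real.rpow_sum_of_pos (by norm_num)]
  exact Finset.prod_congr rfl fun y _ =>
    Real.rpow_logb (by norm_num) (by norm_num) (signWeight_pos h0 h1 _)

lemma patternCost_eq {m : ℕ} (p : ℝ) (f : (Fin (2 + m) → ZMod 2) → ZMod 2)
    (z : Fin 2 → ZMod 2) :
    patternCost p f z = -(2 ^ m - (cosetSupport f z : ℝ)) * Real.logb 2 (1 - p) -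
      cosetSupport f z * Real.logb 2 (p / 2) := by
  have h : ∀ y, Real.logb 2 (signWeight p (walshPattern f z y)) = Real.logb 2 (1 - p) +
      if walsh f (Fin.append z y) ≠ 0 then Real.logb 2 (p / 2) - Real.logb 2 (1 - p) else 0 := by
    intro y
    by_cases h : walsh f (Fin.append z y) = 0 <;> simp [signWeight, walshPattern, h]
  simp only [patternCost, h, Finset.sum_add_distrib]
  rw [← Finset.sum_filter, Finset.sum_const, Finset.sum_const, nsmul_eq_mul, nsmul_eq_mul,
    cosetSupport]
  simp
  ring

lemma IsPlateaued.sum_sliceCost {m s : ℕ} {f : (Fin (2 + m) → ZMod 2) → ZMod 2}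
    (hf : IsPlateaued s f) (hns : (2 + m + s) % 2 = 0) (z : Fin 2 → ZMod 2) :
    ∑ w, sliceCost (planeSlice f w) z = 2 * oddCosets f + Real.logb 2 6 *
      (2 ^ m - 3 / 4 * oddCosets f - cosetSupport f z * 2 ^ s / 4) := by
  have h : ∑ w, (walsh (planeSlice f w) z : ℝ) ^ 2 = cosetSupport f z * 2 ^ (2 + s) := by
    exact_mod_cast hf.sum_sq_walsh_planeSlice hns z
  have h2 : ∑ w, (((∑ u, planeSlice f w u).val : ℕ) : ℝ) = oddCosets f := by
    simp [oddCosets, planeSlice]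
  simp only [sliceCost, Finset.sum_add_distrib, Finset.sum_sub_distrib, ← Finset.mul_sum,
    ← Finset.sum_div, h, h2, Finset.sum_const, Finset.card_univ, Fintype.card_fun,
    Fintype.card_fin, ZMod.card, nsmul_eq_mul]
  push_cast
  ring

/-- The target exponent of the bound. -/
noncomputable def plateauedExponent (m s b : ℕ) : ℝ :=
  (1 + (3 / 8) * Real.logb 2 6) * b + 2 ^ m * (binEnt (1 / 2 ^ s) + 1 / 2 ^ s)

lemma three_mul_logb_six_le : 3 * Real.logb 2 6 ≤ 8 := by
  have h : (3 : ℝ) * Real.logb 2 6 = Real.logb 2 (6 ^ 3) := by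
    rw [Real.logb_pow]; norm_num
  rw [h, Real.logb_le_iff_le_rpow (by norm_num) (by norm_num)]
  norm_num

lemma IsPlateaued.exists_cost_le {m s : ℕ} {f : (Fin (2 + m) → ZMod 2) → ZMod 2}
    (hf : IsPlateaued s f) (hns : (2 + m + s) % 2 = 0) (hodd : 2 * oddCosets f ≤ 2 ^ m)
    (b : ℕ) :
    ∃ z, patternCost (1 / 2 ^ s) f z + b / 2 ^ m * ∑ w, sliceCost (planeSlice f w) z ≤
      plateauedExponent m s b := by
  suffices h : ∑ z, (patternCost (1 / 2 ^ s) f z +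
      b / 2 ^ m * ∑ w, sliceCost (planeSlice f w) z) ≤
      ∑ _z : Fin 2 → ZMod 2, plateauedExponent m s b by
    obtain ⟨z, -, hz⟩ := Finset.exists_le_of_sum_le Finset.univ_nonempty h
    exact ⟨z, hz⟩
  have hodd' : 2 * (oddCosets f : ℝ) ≤ 2 ^ m := by exact_mod_cast hodd
  have hsupp : (∑ z, (cosetSupport f z : ℝ)) = 4 * 2 ^ m / 2 ^ s := by
    rw [eq_div_iff (by positivity)]
    exact_mod_cast hf.sum_cosetSupport hns
  have hlog : Real.logb 2 (1 / 2 ^ s / 2 : ℝ) = Real.logb 2 (1 / 2 ^ s) - 1 := by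
    rw [Real.logb_div (by positivity) (by norm_num), Real.logb_self_eq_one (by norm_num)]
  have hlin : ∀ z, patternCost (1 / 2 ^ s) f z +
      b / 2 ^ m * ∑ w, sliceCost (planeSlice f w) z =
      (-2 ^ m * Real.logb 2 (1 - 1 / 2 ^ s) + b / 2 ^ m * (2 * oddCosets f + Real.logb 2 6 *
      (2 ^ m - 3 / 4 * oddCosets f))) + cosetSupport f z * (Real.logb 2 (1 - 1 / 2 ^ s) -
      Real.logb 2 (1 / 2 ^ s / 2) - b / 2 ^ m * Real.logb 2 6 * 2 ^ s / 4) := by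
    intro z
    rw [patternCost_eq, hf.sum_sliceCost hns]
    ring
  simp only [hlin, Finset.sum_add_distrib, ← Finset.sum_mul, hsupp, hlog]
  simp only [Finset.sum_const, Finset.card_univ, Fintype.card_fun, Fintype.card_fin, ZMod.card,
    nsmul_eq_mul, plateauedExponent, binEnt]
  have hmain : (b : ℝ) / 2 ^ m * (8 - 3 * Real.logb 2 6) * (2 * oddCosets f) ≤
      b / 2 ^ m * (8 - 3 * Real.logb 2 6) * 2 ^ m := by
    refine mul_le_mul_of_nonneg_left hodd' (mul_nonneg (by positivity) ?_)
    linarith [three_mul_logb_six_le]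
  have hm : (2 : ℝ) ^ m ≠ 0 := by positivity
  have hs : (2 : ℝ) ^ s ≠ 0 := by positivity
  generalize Real.logb 2 (1 - 1 / 2 ^ s : ℝ) = l₁ at *
  generalize Real.logb 2 (1 / 2 ^ s : ℝ) = l₂ at *
  rw [← sub_nonneg] at hmain ⊢
  refine (div_nonneg hmain (zero_le_two (α := ℝ))).trans_eq ?_
  push_cast
  field_simp
  ring

/-- Some translate of a ball has at most average cost. -/
lemma exists_translate_sum_le {m : ℕ} (c : (Fin m → ZMod 2) → ℝ)
    (B : Finset (Finset (Fin m))) :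
    ∃ v, ∑ J ∈ B, c (v + indVec J) ≤ B.card / 2 ^ m * ∑ w, c w := by
  suffices h : ∑ v, ∑ J ∈ B, c (v + indVec J) ≤
      ∑ _v : Fin m → ZMod 2, (B.card / 2 ^ m * ∑ w, c w : ℝ) by
    obtain ⟨v, -, hv⟩ := Finset.exists_le_of_sum_le Finset.univ_nonempty h
    exact ⟨v, hv⟩
  rw [Finset.sum_comm]
  have h : ∀ J, ∑ v, c (v + indVec J) = ∑ w, c w := fun J =>
    Equiv.sum_comp (Equiv.addRight (indVec J)) c
  simp only [h, Finset.sum_const, Finset.card_univ, Fintype.card_fun, Fintype.card_fin,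
    ZMod.card, nsmul_eq_mul]
  push_cast
  refine le_of_eq ?_
  field_simp

section Counting

open Classical in
/-- Plateaued functions whose total cost at `z` is at most the target exponent. -/
noncomputable def cheapFunctions (m s r : ℕ) (z : Fin 2 → ZMod 2) :
    Finset ((Fin (2 + m) → ZMod 2) → ZMod 2) :=
  Finset.univ.filter fun f => IsPlateaued s f ∧
    patternCost (1 / 2 ^ s) f z +
      ballCard m r / 2 ^ m * ∑ w, sliceCost (planeSlice f w) z ≤
      plateauedExponent m s (ballCard m r)

open Classical in
lemma card_cheapFunctions_fiber_le {m s r : ℕ} (hs : 0 < s) (hr : 1 ≤ r)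
    (hk : 2 + m + 2 ≤ r + 1 + (2 + m + s) / 2) (z : Fin 2 → ZMod 2)
    (π : (Fin m → ZMod 2) → SignType) :
    (((cheapFunctions m s r z).filter fun f => walshPattern f z = π).card : ℝ) ≤
      2 ^ plateauedExponent m s (ballCard m r) * ∏ y, signWeight (1 / 2 ^ s) (π y) := by
  have hp0 : (0 : ℝ) < 1 / 2 ^ s := by positivity
  have hp1 : (1 : ℝ) / 2 ^ s < 1 := by
    rw [div_lt_one (by positivity)]
    exact one_lt_pow₀ (by norm_num) hs.ne'
  rcases Finset.eq_empty_or_nonempty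
    ((cheapFunctions m s r z).filter fun f => walshPattern f z = π) with he | ⟨f₀, hf₀⟩
  · rw [he, Finset.card_empty, Nat.cast_zero]
    exact mul_nonneg (by positivity)
      (Finset.prod_nonneg fun y _ => (signWeight_pos hp0 hp1 _).le)
  simp only [cheapFunctions, Finset.mem_filter, Finset.mem_univ, true_and] at hf₀
  obtain ⟨⟨hpl₀, hcost⟩, rfl⟩ := hf₀
  obtain ⟨v, hv⟩ := exists_translate_sum_le (fun w => sliceCost (planeSlice f₀ w) z)
    (ballSets m r)
  rw [card_ballSets] at hv
  have hdvd : ∀ f : (Fin (2 + m) → ZMod 2) → ZMod 2, IsPlateaued s f →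
      ∀ y, (2 : ℤ) ^ ((2 + m + s) / 2) ∣ walsh f y := by
    intro f hf y
    rw [hf.walsh_eq_sign y]
    exact Dvd.intro_left _ rfl
  let O : ballSets m r → Finset ((Fin 2 → ZMod 2) → ZMod 2) := fun J =>
    Finset.univ.filter fun t => walsh t z = walsh (planeSlice f₀ (v + indVec J.1)) z
  have hcard : ((cheapFunctions m s r z).filter fun f =>
      walshPattern f z = walshPattern f₀ z).card ≤ (Fintype.piFinset O).card := by
    refine Finset.card_le_card_of_injOn
      (fun f (J : ballSets m r) => planeSlice f (v + indVec J.1)) ?_ ?_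
    · intro f hf
      simp only [cheapFunctions, Finset.coe_filter, Finset.mem_filter, Finset.mem_univ, true_and,
        Set.mem_ofPred_eq] at hf
      simp only [Finset.mem_coe, Fintype.mem_piFinset, O, Finset.mem_filter, Finset.mem_univ,
        true_and]
      exact fun J => walsh_planeSlice_eq hf.1.1 hpl₀ hf.2 _
    · intro f hf f' hf' h
      simp only [cheapFunctions, Finset.coe_filter, Finset.mem_filter, Finset.mem_univ, true_and,
        Set.mem_ofPred_eq] at hf hf'
      exact eq_of_eq_on_ball (hdvd f hf.1.1) (hdvd f' hf'.1.1) hr (by omega) v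
        fun J hJ u => congrFun (congrFun h ⟨J, hJ⟩) u
  calc (((cheapFunctions m s r z).filter fun f =>
      walshPattern f z = walshPattern f₀ z).card : ℝ) ≤ ((Fintype.piFinset O).card : ℝ) := by
        exact_mod_cast hcard
    _ = ∏ J : ballSets m r, ((O J).card : ℝ) := by
        rw [Fintype.card_piFinset]; push_cast; rfl
    _ ≤ ∏ J : ballSets m r, (2 : ℝ) ^ sliceCost (planeSlice f₀ (v + indVec J.1)) z :=
        Finset.prod_le_prod (fun _ _ => by positivity) fun J _ => card_walsh_fiber_le _ _
    _ = 2 ^ ∑ J ∈ ballSets m r, sliceCost (planeSlice f₀ (v + indVec J)) z := by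
        rw [Real.rpow_sum_of_pos (by norm_num)]
        exact Finset.prod_coe_sort (ballSets m r)
          fun J => (2 : ℝ) ^ sliceCost (planeSlice f₀ (v + indVec J)) z
    _ ≤ 2 ^ (plateauedExponent m s (ballCard m r) + -patternCost (1 / 2 ^ s) f₀ z) :=
        Real.rpow_le_rpow_of_exponent_le (by norm_num) (by linarith)
    _ = _ := by
        rw [Real.rpow_add (by norm_num), two_rpow_neg_patternCost hp0 hp1]

lemma card_cheapFunctions_le {m s r : ℕ} (hs : 0 < s) (hr : 1 ≤ r)
    (hk : 2 + m + 2 ≤ r + 1 + (2 + m + s) / 2) (z : Fin 2 → ZMod 2) :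
    ((cheapFunctions m s r z).card : ℝ) ≤ 2 ^ plateauedExponent m s (ballCard m r) := by
  classical
  rw [Finset.card_eq_sum_card_fiberwise (f := fun f => walshPattern f z)
    (t := Finset.univ) (fun _ _ => by simp)]
  push_cast
  refine (Finset.sum_le_sum fun π _ => card_cheapFunctions_fiber_le hs hr hk z π).trans ?_
  rw [← Finset.mul_sum, sum_prod_signWeight, mul_one]

lemma card_linearEquiv_le (n : ℕ) :
    Nat.card ((Fin n → ZMod 2) ≃ₗ[ZMod 2] (Fin n → ZMod 2)) ≤ 2 ^ (n * n) := by
  have h : Nat.card (Matrix (Fin n) (Fin n) (ZMod 2)) = 2 ^ (n * n) := by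
    simp [Nat.card_eq_fintype_card, Matrix, pow_mul]
  rw [← h]
  exact Nat.card_le_card_of_injective
    (fun A : (Fin n → ZMod 2) ≃ₗ[ZMod 2] (Fin n → ZMod 2) => LinearMap.toMatrix' A.toLinearMap)
    (LinearMap.toMatrix'.injective.comp LinearEquiv.toLinearMap_injective)

lemma card_plateaued_le {m s r : ℕ} (hm : 1 ≤ m) (hs : 0 < s) (hns : (2 + m + s) % 2 = 0)
    (hr : 1 ≤ r) (hk : 2 + m + 2 ≤ r + 1 + (2 + m + s) / 2) :
    (Nat.card {f : (Fin (2 + m) → ZMod 2) → ZMod 2 // IsPlateaued s f} : ℝ) ≤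
      2 ^ ((2 + m) * (2 + m)) * (4 * 2 ^ plateauedExponent m s (ballCard m r)) := by
  classical
  let C := Σ z, {f // f ∈ cheapFunctions m s r z}
  have hex : ∀ f : {f : (Fin (2 + m) → ZMod 2) → ZMod 2 // IsPlateaued s f},
      ∃ q : ((Fin (2 + m) → ZMod 2) ≃ₗ[ZMod 2] (Fin (2 + m) → ZMod 2)) × C,
        f.1 ∘ q.1 = q.2.2.1 := by
    rintro ⟨f, hf⟩
    obtain ⟨A, hA⟩ := exists_linearEquiv_oddCosets_le hm f
    obtain ⟨z, hz⟩ := (hf.comp_linearEquiv A).exists_cost_le hns hA (ballCard m r)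
    exact ⟨(A, ⟨z, f ∘ A, by simp [cheapFunctions, hf.comp_linearEquiv A]; simpa using hz⟩), rfl⟩
  choose q hq using hex
  have hinj : Function.Injective q := by
    intro f f' h
    have h1 := hq f
    rw [h, ← hq f'] at h1
    exact Subtype.ext ((q f').1.surjective.injective_comp_right h1)
  have : Finite ((Fin (2 + m) → ZMod 2) ≃ₗ[ZMod 2] (Fin (2 + m) → ZMod 2)) :=
    DFunLike.finite _
  have h1 := Nat.card_le_card_of_injective q hinj
  rw [Nat.card_prod] at h1
  have hC : (Nat.card C : ℝ) ≤ 4 * 2 ^ plateauedExponent m s (ballCard m r) := by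
    simp only [C, Nat.card_eq_fintype_card, Fintype.card_sigma, Fintype.card_coe]
    push_cast
    refine (Finset.sum_le_sum fun z _ => card_cheapFunctions_le hs hr hk z).trans ?_
    simp only [Finset.sum_const, Finset.card_univ, Fintype.card_fun, Fintype.card_fin,
      ZMod.card, nsmul_eq_mul]
    norm_num
  calc _ ≤ ((Nat.card ((Fin (2 + m) → ZMod 2) ≃ₗ[ZMod 2] (Fin (2 + m) → ZMod 2)) *
        Nat.card C : ℕ) : ℝ) := by exact_mod_cast h1
    _ ≤ _ := by
      push_cast
      exact mul_le_mul (by exact_mod_cast card_linearEquiv_le (2 + m)) hC (by positivity)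
        (by positivity)

end Counting

lemma two_pow_div_le_plateauedExponent (m s b : ℕ) :
    (2 : ℝ) ^ m / 2 ^ s ≤ plateauedExponent m s b := by
  have h1 : 0 ≤ Real.logb 2 6 := Real.logb_nonneg (by norm_num) (by norm_num)
  have h2 : (0 : ℝ) ≤ 1 / 2 ^ s := by positivity
  have h3 : (1 : ℝ) / 2 ^ s ≤ 1 := by
    rw [div_le_one (by positivity)]
    exact one_le_pow₀ (by norm_num)
  have h4 := binEnt_nonneg h2 h3
  have h5 : (0 : ℝ) ≤ (1 + (3 / 8) * Real.logb 2 6) * b := by positivity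
  have h6 : (0 : ℝ) ≤ 2 ^ m * binEnt (1 / 2 ^ s) := by positivity
  unfold plateauedExponent
  rw [mul_add, mul_one_div]
  linarith

lemma exists_quadratic_le_two_pow (s : ℕ) {ε : ℝ} (hε : 0 < ε) :
    ∃ N : ℕ, ∀ m ≥ N, (((2 + m) * (2 + m) + 2 : ℕ) : ℝ) ≤ ε * (2 ^ m / 2 ^ s) := by
  have h := tendsto_pow_const_div_const_pow_of_one_lt 2 (one_lt_two (α := ℝ))
  have hc : (0 : ℝ) < ε / 2 ^ s / 11 := by positivity
  obtain ⟨N, hN⟩ := Filter.eventually_atTop.1 (h.eventually_lt_const hc)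
  refine ⟨max N 1, fun m hm => ?_⟩
  have h1 := hN m (le_of_max_le_left hm)
  have h2 : (1 : ℝ) ≤ m := by exact_mod_cast le_of_max_le_right hm
  rw [div_lt_iff₀ (by positivity)] at h1
  push_cast
  have h3 : ε * (2 ^ m / 2 ^ s) = 11 * (ε / 2 ^ s / 11 * 2 ^ m) := by ring
  rw [h3]
  nlinarith

/-- Asymptotic upper bound
`𝒩(n,s) ≤ (α·b(n-2, ⌈(n-s)/2⌉+1) + 2^{n-2}(ℏ(1/2^s) + 1/2^s))(1 + o(1))`,
where `α = 1 + (3/8)·log₂ 6` and `⌈(n-s)/2⌉ = (n - s + 1)/2` in ℕ. -/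
theorem logNumPlateaued_le_ball_bound (s : ℕ) (hs : 0 < s) :
    ∀ ε > (0 : ℝ), ∃ N : ℕ, ∀ n ≥ N, (n + s) % 2 = 0 →
      logNumPlateaued n s ≤ (1 + ε) *
        ((1 + (3 / 8) * Real.logb 2 6) * ballCard (n - 2) ((n - s + 1) / 2 + 1) +
          2 ^ (n - 2) * (binEnt (1 / 2 ^ s) + 1 / 2 ^ s)) := by
  intro ε hε
  obtain ⟨N, hN⟩ := exists_quadratic_le_two_pow s hε
  refine ⟨N + s + 3, fun n hn hns => ?_⟩
  obtain ⟨m, rfl⟩ : ∃ m, n = 2 + m := ⟨n - 2, by omega⟩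
  rw [Nat.add_sub_cancel_left]
  set r := (2 + m - s + 1) / 2 + 1 with hr
  change logNumPlateaued (2 + m) s ≤ (1 + ε) * plateauedExponent m s (ballCard m r)
  have hcard := card_plateaued_le (m := m) (s := s) (r := r) (by omega) hs hns (by omega)
    (by omega)
  have hT := two_pow_div_le_plateauedExponent m s (ballCard m r)
  set T := plateauedExponent m s (ballCard m r)
  have hpow : (2 : ℝ) ^ ((2 + m) * (2 + m)) * (4 * 2 ^ T) =
      2 ^ ((((2 + m) * (2 + m) + 2 : ℕ) : ℝ) + T) := by
    rw [Real.rpow_add (by norm_num), Real.rpow_natCast, pow_add]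
    ring
  rw [hpow] at hcard
  have hlog : logNumPlateaued (2 + m) s ≤ (((2 + m) * (2 + m) + 2 : ℕ) : ℝ) + T := by
    unfold logNumPlateaued
    rcases Nat.eq_zero_or_pos
      (Nat.card {f : (Fin (2 + m) → ZMod 2) → ZMod 2 // IsPlateaued s f}) with h0 | h0
    · rw [h0, Nat.cast_zero, Real.logb_zero]
      have : (0 : ℝ) ≤ 2 ^ m / 2 ^ s := by positivity
      exact add_nonneg (by positivity) (this.trans hT)
    · rwa [Real.logb_le_iff_le_rpow (by norm_num) (by exact_mod_cast h0)]
  have h1 := hN m (by omega)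
  have h2 := mul_le_mul_of_nonneg_left hT hε.le
  linarith
end
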